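/- Let A be an m-th order n-dimensional real tensor and a ∈ ℝ^n with a in the interior of the dual cone Sol(A,0)^+ = { q ∈ ℝ^n : ⟨v,q⟩ ≥ 0 for all v ∈ Sol(A,0) }. Then there exists ε > 0 such that for every copositive tensor B ∈ ℝ^{[m,n]} and every b ∈ ℝ^n satisfying max{‖B − A‖, ‖b − a‖} < ε, the solution set Sol(B,b) is nonempty and bounded. -/

import Mathlib

open Finset MeasureTheory Pointwise

/-- For a tensor `A` of order `k+1` and dimension `n` (entries `A i j` = `a_{i, j 0, …, j (k-1)}`),
`tApply A x` is the vector `A x^{k}` with `i`-th component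
`∑_{i_2,…,i_{k+1}} a_{i i_2 ⋯ i_{k+1}} x_{i_2} ⋯ x_{i_{k+1}}`. -/
noncomputable def tApply {n k : ℕ} (A : Fin n → (Fin k → Fin n) → ℝ) (x : Fin n → ℝ) :
    Fin n → ℝ :=
  fun i => ∑ j : Fin k → Fin n, A i j * ∏ l : Fin k, x (j l)

/-- The solution set of the tensor complementarity problem `TCP(A,a)`. -/
def Sol {n k : ℕ} (A : Fin n → (Fin k → Fin n) → ℝ) (a : Fin n → ℝ) : Set (Fin n → ℝ) :=
  {x | (∀ i, 0 ≤ x i) ∧ (∀ i, 0 ≤ tApply A x i + a i) ∧ ∑ i, x i * (tApply A x i + a i) = 0}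

/-- `A` is an R₀-tensor if `Sol(A,0) = {0}`. -/
def IsR0 {n k : ℕ} (A : Fin n → (Fin k → Fin n) → ℝ) : Prop := Sol A 0 = {0}

/-- Frobenius norm of a tensor. -/
noncomputable def tNorm {n k : ℕ} (A : Fin n → (Fin k → Fin n) → ℝ) : ℝ :=
  Real.sqrt (∑ i, ∑ j, (A i j) ^ 2)

/-- Euclidean norm of a vector in ℝⁿ. -/
noncomputable def eNorm {n : ℕ} (x : Fin n → ℝ) : ℝ := Real.sqrt (∑ i, (x i) ^ 2)


lemma aux_perturb_bij {E : Type*} [NormedAddCommGroup E] [NormedSpace ℝ E] [CompleteSpace E]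
    (h : E → E) (K : NNReal) (hK : K < 1) (hh : LipschitzWith K h) :
    Function.Bijective (fun x => x + h x) := by
  constructor
  · intro x y hxy
    have h1 : x - y = h y - h x := by
      have : x + h x = y + h y := hxy
      rw [sub_eq_sub_iff_add_eq_add, this]; abel
    have h2 := hh.dist_le_mul y x
    rw [dist_eq_norm, dist_eq_norm, ← h1, norm_sub_rev y x] at h2
    have hK' : (K : ℝ) < 1 := by exact_mod_cast hK
    have : ‖x - y‖ = 0 := by nlinarith [norm_nonneg (x - y)]
    exact sub_eq_zero.1 (norm_eq_zero.1 this)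
  · intro y
    have hc : ContractingWith K (fun x => y - h x) := by
      refine ⟨hK, LipschitzWith.of_dist_le_mul fun a b => ?_⟩
      have := hh.dist_le_mul a b
      rw [dist_sub_left]
      exact this
    refine ⟨hc.fixedPoint, ?_⟩
    have := hc.fixedPoint_isFixedPt
    have h2 : y - h hc.fixedPoint = hc.fixedPoint := this
    show hc.fixedPoint + h hc.fixedPoint = y
    rw [← eq_sub_iff_add_eq]
    exact h2.symm

lemma aux_small {n : ℕ} (g : (Fin n → ℝ) → (Fin n → ℝ)) (hg : ContDiff ℝ 1 g) (R : ℝ)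
    (hsupp : ∀ x, R < ‖x‖ → g x = 0) (hc : HasCompactSupport g) :
    ∃ t0 > (0 : ℝ), ∀ t, 0 < t → t < t0 → ∀ φ : (Fin n → ℝ) → ℝ,
      ∫ x in Metric.closedBall (0 : Fin n → ℝ) R, φ x =
      ∫ x in Metric.closedBall (0 : Fin n → ℝ) R,
        (ContinuousLinearMap.id ℝ (Fin n → ℝ) + t • fderiv ℝ g x).det * φ (x + t • g x) := by
  obtain ⟨K, hK⟩ := hg.lipschitzWith_of_hasCompactSupport hc one_ne_zero
  have hdet : ∃ η > (0 : ℝ), ∀ L : (Fin n → ℝ) →L[ℝ] (Fin n → ℝ), ‖L‖ < η →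
      0 < (ContinuousLinearMap.id ℝ (Fin n → ℝ) + L).det := by
    have hcont : Continuous fun L : (Fin n → ℝ) →L[ℝ] (Fin n → ℝ) =>
        (ContinuousLinearMap.id ℝ (Fin n → ℝ) + L).det :=
      ContinuousLinearMap.continuous_det.comp (by fun_prop)
    have h0 : (fun L : (Fin n → ℝ) →L[ℝ] (Fin n → ℝ) =>
        (ContinuousLinearMap.id ℝ (Fin n → ℝ) + L).det) 0 > 0 := by
      simp [ContinuousLinearMap.det]
    have := hcont.continuousAt.eventually (lt_mem_nhds h0)
    obtain ⟨η, hη, h⟩ := Metric.eventually_nhds_iff.1 this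
    exact ⟨η, hη, fun L hL => h (by simpa using hL)⟩
  obtain ⟨η, hη, hdet⟩ := hdet
  refine ⟨min 1 η / (K + 1), by positivity, fun t ht ht0 φ => ?_⟩
  have hKt : t * (K + 1) < min 1 η := by rwa [lt_div_iff₀ (by positivity)] at ht0
  have hK0 : (0:ℝ) ≤ K := K.2
  have hKt1 : t * K < 1 := by nlinarith [min_le_left 1 η]
  have hKt2 : t * K < η := by nlinarith [min_le_right 1 η]
  have hbij : Function.Bijective (fun x => x + t • g x) := by
    refine aux_perturb_bij (fun x => t • g x) (Real.toNNReal t * K) ?_ ?_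
    · rw [← NNReal.coe_lt_coe]; push_cast; rw [Real.coe_toNNReal _ ht.le]; exact hKt1
    · refine LipschitzWith.of_dist_le_mul fun a b => ?_
      have := hK.dist_le_mul a b
      rw [dist_smul₀, Real.norm_of_nonneg ht.le]
      push_cast
      rw [Real.coe_toNNReal _ ht.le, mul_assoc]
      exact mul_le_mul_of_nonneg_left this ht.le
  have himg : (fun x => x + t • g x) '' Metric.closedBall 0 R = Metric.closedBall 0 R := by
    have hout : ∀ x, x ∉ Metric.closedBall (0 : Fin n → ℝ) R → x + t • g x = x := by
      intro x hx
      rw [hsupp x (by simpa using hx)]; simp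
    ext y
    constructor
    · rintro ⟨x, hx, rfl⟩
      by_contra hy
      have := hout _ hy
      have h2 := hbij.1 this
      simp only at h2 hy
      rw [h2] at hy
      exact hy hx
    · intro hy
      obtain ⟨x, hx⟩ := hbij.2 y
      refine ⟨x, ?_, hx⟩
      by_contra hxn
      have := hout x hxn
      simp only at hx
      rw [this] at hx
      exact hxn (hx ▸ hy)
  have hcov := integral_image_eq_integral_abs_det_fderiv_smul (volume : Measure (Fin n → ℝ))
    (s := Metric.closedBall 0 R) (f := fun x => x + t • g x)
    (f' := fun x => ContinuousLinearMap.id ℝ (Fin n → ℝ) + t • fderiv ℝ g x)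
    Metric.isClosed_closedBall.measurableSet
    (fun x _ => ((hasFDerivAt_id x).add
      (((hg.differentiable one_ne_zero) x).hasFDerivAt.const_smul t)).hasFDerivWithinAt)
    hbij.1.injOn φ
  rw [himg] at hcov
  rw [hcov]
  refine integral_congr_ae (Filter.Eventually.of_forall fun x => ?_)
  simp only [smul_eq_mul]
  rw [abs_of_pos]
  apply hdet
  rw [norm_smul, Real.norm_of_nonneg ht.le]
  refine lt_of_le_of_lt ?_ hKt2
  exact mul_le_mul_of_nonneg_left (norm_fderiv_le_of_lipschitz ℝ hK) ht.le

/-- The integral identity persists up to `t = 1` for polynomial weights. -/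
lemma aux_poly {n : ℕ} (g : (Fin n → ℝ) → (Fin n → ℝ)) (hg : ContDiff ℝ 1 g) (R : ℝ)
    (hsupp : ∀ x, R < ‖x‖ → g x = 0) (hc : HasCompactSupport g) (M : ℝ) (N : ℕ) :
      ∫ x in Metric.closedBall (0 : Fin n → ℝ) R, (M - ∑ i, (x i) ^ 2) ^ N =
      ∫ x in Metric.closedBall (0 : Fin n → ℝ) R,
        (ContinuousLinearMap.id ℝ (Fin n → ℝ) + fderiv ℝ g x).det *
          (M - ∑ i, ((x + g x) i) ^ 2) ^ N := by
  obtain ⟨t0, ht0, H⟩ := aux_small g hg R hsupp hc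
  have hgc : Continuous g := hg.continuous
  have hgd : Continuous (fderiv ℝ g) := hg.continuous_fderiv one_ne_zero
  -- polynomial over the ring of continuous functions
  let cx : Fin n → C(Fin n → ℝ, ℝ) := fun i => ⟨fun x => x i, by fun_prop⟩
  let cg : Fin n → C(Fin n → ℝ, ℝ) := fun i => ⟨fun x => g x i, by fun_prop⟩
  let cd : Matrix (Fin n) (Fin n) C(Fin n → ℝ, ℝ) :=
    fun i j => ⟨fun x => fderiv ℝ g x (Pi.single j 1) i, by fun_prop⟩
  let D : Matrix (Fin n) (Fin n) (Polynomial C(Fin n → ℝ, ℝ)) :=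
    fun i j => (if i = j then 1 else 0) + Polynomial.X * Polynomial.C (cd i j)
  let p : Polynomial C(Fin n → ℝ, ℝ) :=
    D.det * (Polynomial.C (ContinuousMap.const _ M) -
      ∑ i, (Polynomial.C (cx i) + Polynomial.X * Polynomial.C (cg i)) ^ 2) ^ N
  let ev : (Fin n → ℝ) → C(Fin n → ℝ, ℝ) →+* ℝ := fun x =>
    { toFun := fun f => f x, map_one' := rfl, map_mul' := fun _ _ => rfl,
      map_zero' := rfl, map_add' := fun _ _ => rfl }
  have hevap : ∀ x f, ev x f = f x := fun _ _ => rfl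
  have hev : ∀ (t : ℝ) (x : Fin n → ℝ), p.eval₂ (ev x) t =
      (ContinuousLinearMap.id ℝ (Fin n → ℝ) + t • fderiv ℝ g x).det *
        (M - ∑ i, ((x + t • g x) i) ^ 2) ^ N := by
    intro t x
    rw [← Polynomial.coe_eval₂RingHom]
    simp only [p, map_mul, map_pow, map_sub, map_sum, map_add]
    congr 1
    · rw [RingHom.map_det, ContinuousLinearMap.det, ← LinearMap.det_toMatrix']
      congr 1
      ext i j
      show Polynomial.eval₂RingHom (ev x) t (D i j) = _
      simp only [D, LinearMap.toMatrix'_apply, map_add, map_mul]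
      by_cases hij : i = j
      · subst hij
        simp [hevap, cd]
      · simp [hevap, cd, hij]
    · simp [hevap, cx, cg]
  let q : Polynomial ℝ := ∑ k ∈ range (p.natDegree + 1),
    Polynomial.C (∫ x in Metric.closedBall (0 : Fin n → ℝ) R, (p.coeff k) x) * Polynomial.X ^ k
  have hq : ∀ t : ℝ, q.eval t = ∫ x in Metric.closedBall (0 : Fin n → ℝ) R,
      (ContinuousLinearMap.id ℝ (Fin n → ℝ) + t • fderiv ℝ g x).det *
        (M - ∑ i, ((x + t • g x) i) ^ 2) ^ N := by
    intro t
    simp_rw [← hev, Polynomial.eval₂_eq_sum_range]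
    rw [integral_finsetSum]
    · simp only [q, Polynomial.eval_finsetSum, Polynomial.eval_mul, Polynomial.eval_C,
        Polynomial.eval_pow, Polynomial.eval_X]
      refine sum_congr rfl fun k _ => ?_
      rw [integral_mul_const]
      rfl
    · intro k _
      refine ContinuousOn.integrableOn_compact (isCompact_closedBall _ _) ?_
      have : Continuous fun x => ((p.coeff k) x) * t ^ k := by fun_prop
      exact this.continuousOn
  have hqc : q = Polynomial.C
      (∫ x in Metric.closedBall (0 : Fin n → ℝ) R, (M - ∑ i, (x i) ^ 2) ^ N) := by
    refine Polynomial.eq_of_infinite_eval_eq _ _ ((Set.Ioo_infinite ht0).mono ?_)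
    intro t ht
    simp only [Set.mem_ofPred_eq, Polynomial.eval_C, hq]
    exact (H t ht.1 ht.2 (fun y => (M - ∑ i, (y i) ^ 2) ^ N)).symm
  have := hq 1
  rw [hqc, Polynomial.eval_C] at this
  simpa using this

lemma aux_zero_smooth {n : ℕ} (g : (Fin n → ℝ) → (Fin n → ℝ)) (hg : ContDiff ℝ 1 g)
    (hc : HasCompactSupport g) : ∃ x, x + g x = 0 := by
  by_contra! hne
  obtain ⟨R, hR0, hR⟩ : ∃ R > 0, ∀ x, R < ‖x‖ → g x = 0 := by
    obtain ⟨R, hR⟩ := hc.isCompact.isBounded.exists_pos_norm_le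
    refine ⟨R, hR.1, fun x hx => ?_⟩
    by_contra h
    exact absurd (hR.2 x (subset_tsupport _ h)) (not_le.2 hx)
  have hgc : Continuous g := hg.continuous
  have hgd : Continuous (fderiv ℝ g) := hg.continuous_fderiv one_ne_zero
  set Bl := Metric.closedBall (0 : Fin n → ℝ) R with hBl
  have hBc : IsCompact Bl := isCompact_closedBall _ _
  have hBn : Bl.Nonempty := ⟨0, by simp [hBl, hR0.le]⟩
  let Q : (Fin n → ℝ) → ℝ := fun y => ∑ i, (y i) ^ 2
  have hQc : Continuous Q := by fun_prop
  have hQ0 : ∀ y, 0 ≤ Q y := fun y => sum_nonneg fun i _ => sq_nonneg _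
  have hQpos : ∀ y, y ≠ 0 → 0 < Q y := by
    intro y hy
    obtain ⟨i, hi⟩ := Function.ne_iff.1 hy
    exact lt_of_lt_of_le (by have : y i ≠ 0 := hi; positivity)
      (single_le_sum (f := fun i => (y i) ^ 2) (fun i _ => sq_nonneg _) (mem_univ i))
  obtain ⟨x0, _, hx0⟩ := hBc.exists_isMinOn hBn
    (f := fun x => Q (x + g x)) (by fun_prop)
  set δ := Q (x0 + g x0) with hδ
  have hδpos : 0 < δ := hQpos _ (hne x0)
  obtain ⟨M1, hM1⟩ := hBc.exists_bound_of_continuousOn (f := fun x => Q (x + g x)) (by fun_prop)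
  obtain ⟨M2, hM2⟩ := hBc.exists_bound_of_continuousOn (f := Q) (by fun_prop)
  have hdc : Continuous fun x =>
      (ContinuousLinearMap.id ℝ (Fin n → ℝ) + fderiv ℝ g x).det :=
    ContinuousLinearMap.continuous_det.comp (by fun_prop)
  obtain ⟨C, hC⟩ := hBc.exists_bound_of_continuousOn hdc.continuousOn
  set M := max (max M1 M2) (δ + 1) with hM
  have hMδ : δ + 1 ≤ M := le_max_right _ _
  have hM1' : ∀ x ∈ Bl, Q (x + g x) ≤ M := fun x hx =>
    (le_abs_self _).trans ((hM1 x hx).trans ((le_max_left _ _).trans (le_max_left _ _)))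
  have hM2' : ∀ x ∈ Bl, Q x ≤ M := fun x hx =>
    (le_abs_self _).trans ((hM2 x hx).trans ((le_max_right _ _).trans (le_max_left _ _)))
  have key := fun N => aux_poly g hg R hR hc M N
  set V := volume.real Bl
  set U := Bl ∩ {y | Q y < δ / 2} with hU
  have hUm : MeasurableSet U :=
    (Metric.isClosed_closedBall.measurableSet).inter (isOpen_lt hQc continuous_const).measurableSet
  have hUfin : volume U ≠ ⊤ :=
    (lt_of_le_of_lt (measure_mono Set.inter_subset_left) hBc.measure_lt_top).ne
  have hUpos : 0 < volume.real U := by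
    rw [Measure.real, ENNReal.toReal_pos_iff]
    refine ⟨?_, hUfin.lt_top⟩
    refine Measure.measure_pos_of_mem_nhds _ (x := 0) ?_
    refine Filter.inter_mem (Metric.closedBall_mem_nhds _ hR0) ?_
    refine (isOpen_lt hQc continuous_const).mem_nhds ?_
    simp [Q, hδpos]
  have hC0 : 0 ≤ C := (norm_nonneg _).trans (hC 0 (by simp [hBl, hR0.le]))
  have hup : ∀ N : ℕ, ∫ x in Bl, (ContinuousLinearMap.id ℝ (Fin n → ℝ) + fderiv ℝ g x).det *
          (M - ∑ i, ((x + g x) i) ^ 2) ^ N ≤ C * (M - δ) ^ N * V := by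
    intro N
    refine (le_abs_self _).trans ?_
    rw [← Real.norm_eq_abs]
    refine norm_setIntegral_le_of_norm_le_const hBc.measure_lt_top ?_
    intro x hx
    rw [norm_mul, norm_pow]
    refine mul_le_mul (hC x hx) ?_ (by positivity) hC0
    have h1 : Q (x + g x) ≤ M := hM1' x hx
    have h2 : δ ≤ Q (x + g x) := hx0 hx
    refine pow_le_pow_left₀ (norm_nonneg _) ?_ _
    show ‖M - Q (x + g x)‖ ≤ _
    rw [Real.norm_of_nonneg (by linarith)]
    linarith
  have hlow : ∀ N : ℕ, (M - δ / 2) ^ N * volume.real U ≤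
      ∫ x in Bl, (M - ∑ i, (x i) ^ 2) ^ N := by
    intro N
    have hint : IntegrableOn (fun x : Fin n → ℝ => (M - ∑ i, (x i) ^ 2) ^ N) Bl :=
      ContinuousOn.integrableOn_compact hBc (by fun_prop)
    calc (M - δ / 2) ^ N * volume.real U = ∫ x in U, (M - δ / 2) ^ N := by
            simp [mul_comm]
      _ ≤ ∫ x in U, (M - ∑ i, (x i) ^ 2) ^ N := by
            refine setIntegral_mono_on (integrableOn_const hUfin)
              (hint.mono_set Set.inter_subset_left) hUm fun x hx => ?_
            have : Q x < δ / 2 := hx.2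
            refine pow_le_pow_left₀ (by linarith) ?_ _
            show _ ≤ M - Q x
            linarith
      _ ≤ _ := by
            refine setIntegral_mono_set hint ?_ (Filter.Eventually.of_forall Set.inter_subset_left)
            refine (ae_restrict_iff' Metric.isClosed_closedBall.measurableSet).2
              (Filter.Eventually.of_forall fun x hx => ?_)
            have : Q x ≤ M := hM2' x hx
            exact pow_nonneg (show 0 ≤ M - Q x by linarith) _
  have hfin : ∀ N : ℕ, volume.real U ≤ C * V * ((M - δ) / (M - δ / 2)) ^ N := by
    intro N
    have h := (hlow N).trans ((key N).le.trans (hup N))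
    have hp : 0 < (M - δ / 2) ^ N := pow_pos (by linarith) _
    rw [div_pow, mul_div_assoc', le_div_iff₀ hp]
    linarith
  have hlim : Filter.Tendsto (fun N : ℕ => C * V * ((M - δ) / (M - δ / 2)) ^ N) Filter.atTop
      (nhds (C * V * 0)) := by
    refine Filter.Tendsto.const_mul _ (tendsto_pow_atTop_nhds_zero_of_lt_one ?_ ?_)
    · exact div_nonneg (by linarith) (by linarith)
    · rw [div_lt_one (by linarith)]; linarith
  have := ge_of_tendsto' hlim hfin
  linarith

/-- A continuous map at bounded distance from the identity has a zero. -/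
lemma aux_zero_cont {n : ℕ} (h : (Fin n → ℝ) → (Fin n → ℝ)) (hcont : Continuous h) (M : ℝ)
    (hM : ∀ x, ‖h x‖ ≤ M) : ∃ x, x + h x = 0 := by
  have hM0 : 0 ≤ M := (norm_nonneg _).trans (hM 0)
  let χ : (Fin n → ℝ) → ℝ := fun x => max 0 (min 1 (M + 3 - ‖x‖))
  have hχc : Continuous χ := by fun_prop
  have hχ0 : ∀ x, 0 ≤ χ x := fun x => le_max_left _ _
  have hχ1 : ∀ x, χ x ≤ 1 := fun x => max_le zero_le_one (min_le_left _ _)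
  have hχeq : ∀ x, ‖x‖ ≤ M + 2 → χ x = 1 := by
    intro x hx
    simp only [χ]
    rw [min_eq_left (by linarith)]; simp
  have hkc : Continuous fun x => χ x • h x := by fun_prop
  have hks : HasCompactSupport fun x => χ x • h x := by
    refine HasCompactSupport.of_support_subset_isCompact
      (isCompact_closedBall (0 : Fin n → ℝ) (M + 3)) fun x hx => ?_
    by_contra hn
    apply hx
    have : M + 3 < ‖x‖ := by simpa using hn
    have : χ x = 0 := by
      simp only [χ]
      exact max_eq_left ((min_le_right _ _).trans (by linarith))
    simp [this]
  have happ : ∀ k : ℕ, ∃ x : Fin n → ℝ, ‖x‖ ≤ M + 1 ∧ ‖x + h x‖ ≤ 1 / ((k : ℝ) + 1) := by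
    intro k
    have hε : (0:ℝ) < 1 / ((k : ℝ) + 1) := by positivity
    have hε1 : 1 / ((k : ℝ) + 1) ≤ 1 := by
      rw [div_le_one (by positivity)]; linarith [(Nat.cast_nonneg k : (0:ℝ) ≤ k)]
    obtain ⟨g, hg1, hg2, hg3⟩ := hkc.exists_contDiff_approx 1
      (ε := fun _ => 1 / ((k : ℝ) + 1)) continuous_const (fun _ => hε)
    have hgs : HasCompactSupport g := hks.mono hg3
    obtain ⟨x, hx⟩ := aux_zero_smooth g (by exact_mod_cast hg1) hgs
    have hd := hg2 x
    rw [dist_eq_norm] at hd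
    have hgx : g x = -x := by rw [eq_neg_iff_add_eq_zero, add_comm]; exact hx
    have hkn : ‖χ x • h x‖ ≤ M := by
      rw [norm_smul, Real.norm_of_nonneg (hχ0 x)]
      nlinarith [hM x, hχ0 x, hχ1 x, norm_nonneg (h x)]
    have hxn : ‖x‖ ≤ M + 1 := by
      have : ‖x‖ = ‖(g x - χ x • h x) + χ x • h x‖ := by rw [sub_add_cancel, hgx, norm_neg]
      rw [this]
      refine (norm_add_le _ _).trans ?_
      linarith
    refine ⟨x, hxn, ?_⟩
    rw [hχeq x (by linarith), one_smul, hgx] at hd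
    have : ‖-x - h x‖ = ‖x + h x‖ := by rw [← norm_neg]; congr 1; abel
    linarith
  choose u hu1 hu2 using happ
  obtain ⟨x, -, ψ, hψ, hlim⟩ := (isCompact_closedBall (0 : Fin n → ℝ) (M + 1)).tendsto_subseq
    (x := u) (fun k => by simpa using hu1 k)
  refine ⟨x, ?_⟩
  have hc2 : Continuous fun x => ‖x + h x‖ := by fun_prop
  have h1 := (hc2.tendsto x).comp hlim
  have h2 := (tendsto_one_div_add_atTop_nhds_zero_nat (𝕜 := ℝ)).comp hψ.tendsto_atTop
  have := le_of_tendsto_of_tendsto' h1 h2 (fun k => hu2 (ψ k))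
  exact norm_le_zero_iff.1 this

/-- Existence for the variational inequality on a box. -/
lemma aux_box {n : ℕ} (F : (Fin n → ℝ) → (Fin n → ℝ)) (hF : Continuous F) (R : ℝ) (hR : 0 < R) :
    ∃ z : Fin n → ℝ, (∀ i, 0 ≤ z i) ∧ (∀ i, z i ≤ R) ∧ (∀ i, z i < R → 0 ≤ F z i) ∧
      (∀ i, 0 < z i → F z i ≤ 0) := by
  let c : (Fin n → ℝ) → (Fin n → ℝ) := fun x i => max 0 (min R (x i))
  have hcc : Continuous c := by fun_prop
  have hc0 : ∀ x i, 0 ≤ c x i := fun x i => le_max_left _ _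
  have hcR : ∀ x i, c x i ≤ R := fun x i => max_le hR.le (min_le_left _ _)
  have hcb : ∀ x, ‖c x‖ ≤ R := fun x => by
    rw [pi_norm_le_iff_of_nonneg hR.le]
    intro i
    rw [Real.norm_of_nonneg (hc0 x i)]; exact hcR x i
  obtain ⟨C, hC⟩ := (isCompact_closedBall (0 : Fin n → ℝ) R).exists_bound_of_continuousOn
    hF.continuousOn
  obtain ⟨x, hx⟩ := aux_zero_cont (fun x => F (c x) - c x) (by fun_prop) (C + R) (fun x =>
    (norm_sub_le _ _).trans (add_le_add (hC _ (by simpa using hcb x)) (hcb x)))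
  have hx' : ∀ i, F (c x) i = c x i - x i := fun i => by
    have := congrFun hx i
    simp only [Pi.add_apply, Pi.sub_apply, Pi.zero_apply] at this
    linarith
  refine ⟨c x, hc0 x, hcR x, fun i hi => ?_, fun i hi => ?_⟩
  · rw [hx' i]
    have h1 : min R (x i) ≤ c x i := le_max_right _ _
    rcases min_le_iff.1 h1 with h | h <;> linarith
  · rw [hx' i]
    have : c x i ≤ x i := by
      simp only [c] at hi ⊢
      rcases lt_max_iff.1 hi with h | h
      · exact absurd h (lt_irrefl _)
      · rw [max_eq_right h.le]; exact min_le_right _ _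
    linarith

lemma tApply_cont {n k : ℕ} :
    Continuous fun p : (Fin n → (Fin k → Fin n) → ℝ) × (Fin n → ℝ) => tApply p.1 p.2 := by
  unfold tApply
  fun_prop

lemma tApply_cont_comp {n k : ℕ} {X : Type*} [TopologicalSpace X]
    {f : X → (Fin n → (Fin k → Fin n) → ℝ)} {g : X → Fin n → ℝ} (hf : Continuous f)
    (hg : Continuous g) (i : Fin n) : Continuous fun x => tApply (f x) (g x) i :=
  (continuous_apply i).comp (tApply_cont.comp (hf.prodMk hg))

lemma tApply_smul {n k : ℕ} (A : Fin n → (Fin k → Fin n) → ℝ) (s : ℝ) (x : Fin n → ℝ)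
    (i : Fin n) : tApply A (s • x) i = s ^ k * tApply A x i := by
  simp only [tApply, Pi.smul_apply, smul_eq_mul, prod_mul_distrib, prod_const, card_univ,
    Fintype.card_fin, mul_sum]
  refine sum_congr rfl fun j _ => ?_
  ring

lemma aux_dual {n k : ℕ} (A : Fin n → (Fin k → Fin n) → ℝ) (a : Fin n → ℝ)
    (ha : a ∈ interior {q : Fin n → ℝ | ∀ v ∈ Sol A 0, 0 ≤ ∑ i, v i * q i})
    (v : Fin n → ℝ) (hv : v ∈ Sol A 0) (hv0 : v ≠ 0) : 0 < ∑ i, v i * a i := by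
  have hc : ContinuousAt (fun t : ℝ => a - t • v) 0 := by fun_prop
  have hmem := hc.preimage_mem_nhds (t := {q : Fin n → ℝ | ∀ v ∈ Sol A 0, 0 ≤ ∑ i, v i * q i})
    (by simpa using mem_interior_iff_mem_nhds.1 ha)
  obtain ⟨δ, hδ, h⟩ := Metric.mem_nhds_iff.1 hmem
  have h1 : (δ / 2) ∈ Metric.ball (0 : ℝ) δ := by
    simp [abs_of_pos hδ, hδ]
  have h2 : 0 ≤ ∑ i, v i * (a - (δ / 2) • v) i := h h1 v hv
  have h3 : ∑ i, v i * (a - (δ / 2) • v) i = ∑ i, v i * a i - δ / 2 * ∑ i, (v i) ^ 2 := by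
    rw [mul_sum, ← sum_sub_distrib]
    refine sum_congr rfl fun i _ => ?_
    simp; ring
  have h4 : 0 < ∑ i, (v i) ^ 2 := by
    obtain ⟨i, hi⟩ := Function.ne_iff.1 hv0
    exact lt_of_lt_of_le (by have : v i ≠ 0 := hi; positivity)
      (single_le_sum (f := fun i => (v i) ^ 2) (fun i _ => sq_nonneg _) (mem_univ i))
  rw [h3] at h2
  nlinarith

lemma Sol_smul {n k : ℕ} (A : Fin n → (Fin k → Fin n) → ℝ) (v : Fin n → ℝ) (hv : v ∈ Sol A 0)
    (s : ℝ) (hs : 0 ≤ s) : s • v ∈ Sol A 0 := by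
  obtain ⟨h1, h2, h3⟩ := hv
  refine ⟨fun i => mul_nonneg hs (h1 i), fun i => ?_, ?_⟩
  · rw [tApply_smul]
    have := h2 i
    simp only [Pi.zero_apply, add_zero] at this ⊢
    positivity
  · have : ∑ i, (s • v) i * (tApply A (s • v) i + (0 : Fin n → ℝ) i) =
        s * s ^ k * ∑ i, v i * (tApply A v i + (0 : Fin n → ℝ) i) := by
      rw [mul_sum]
      refine sum_congr rfl fun i _ => ?_
      rw [tApply_smul]
      simp; ring
    rw [this, h3, mul_zero]

lemma aux_eps {n k : ℕ} (A : Fin n → (Fin k → Fin n) → ℝ) (a : Fin n → ℝ)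
    (ha : ∀ v ∈ Sol A 0, v ≠ 0 → 0 < ∑ i, v i * a i) :
    ∃ ε > (0 : ℝ), ∀ (B : Fin n → (Fin k → Fin n) → ℝ) (b : Fin n → ℝ),
      max (tNorm (B - A)) (eNorm (b - a)) < ε →
      ∀ v ∈ Sol B 0, v ≠ 0 → 0 < ∑ i, v i * b i := by
  have hcl : IsClosed {z : ((Fin n → (Fin k → Fin n) → ℝ) × (Fin n → ℝ)) × (Fin n → ℝ) |
      ((∀ i, 0 ≤ z.2 i) ∧ (∀ i, 0 ≤ tApply z.1.1 z.2 i + (0 : Fin n → ℝ) i) ∧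
        ∑ i, z.2 i * (tApply z.1.1 z.2 i + (0 : Fin n → ℝ) i) = 0) ∧
        ∑ i, z.2 i * z.1.2 i ≤ 0} := by
    have hT : ∀ i, Continuous fun z : ((Fin n → (Fin k → Fin n) → ℝ) × (Fin n → ℝ)) × (Fin n → ℝ) =>
        tApply z.1.1 z.2 i := fun i => tApply_cont_comp (by fun_prop) (by fun_prop) i
    simp only [Set.ofPred_and, Set.ofPred_forall]
    refine IsClosed.inter (IsClosed.inter ?_ (IsClosed.inter ?_ ?_)) ?_
    · exact isClosed_iInter fun i => isClosed_le continuous_const (by fun_prop)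
    · exact isClosed_iInter fun i => isClosed_le continuous_const (by fun_prop)
    · exact isClosed_eq (by fun_prop) continuous_const
    · exact isClosed_le (by fun_prop) continuous_const
  have hev : ∀ᶠ p in nhds (A, a), ∀ v ∈ Metric.sphere (0 : Fin n → ℝ) 1,
      ¬ (v ∈ Sol p.1 0 ∧ ∑ i, v i * p.2 i ≤ 0) := by
    refine (isCompact_sphere (0 : Fin n → ℝ) 1).eventually_forall_of_forall_eventually
      fun v hv => ?_
    refine hcl.isOpen_compl.mem_nhds ?_
    rintro ⟨h1, h2⟩
    refine absurd (ha v h1 ?_) (not_lt.2 h2)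
    rintro rfl
    simp at hv
  obtain ⟨ε, hε, h⟩ := Metric.eventually_nhds_iff.1 hev
  refine ⟨ε, hε, fun B b hBb v hv hv0 => ?_⟩
  have hd : dist (B, b) (A, a) < ε := by
    obtain ⟨h1, h2⟩ := max_lt_iff.1 hBb
    rw [Prod.dist_eq]
    refine max_lt (lt_of_le_of_lt ?_ h1) (lt_of_le_of_lt ?_ h2)
    · refine (dist_pi_le_iff (Real.sqrt_nonneg _)).2 fun i => ?_
      refine (dist_pi_le_iff (Real.sqrt_nonneg _)).2 fun j => ?_
      refine Real.le_sqrt_of_sq_le ?_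
      rw [Real.dist_eq, sq_abs]
      refine le_trans ?_ (single_le_sum (f := fun i => ∑ j, ((B - A) i j) ^ 2)
        (fun i _ => sum_nonneg fun j _ => sq_nonneg _) (mem_univ i))
      exact single_le_sum (f := fun j => ((B - A) i j) ^ 2) (fun j _ => sq_nonneg _) (mem_univ j)
    · refine (dist_pi_le_iff (Real.sqrt_nonneg _)).2 fun i => ?_
      refine Real.le_sqrt_of_sq_le ?_
      rw [Real.dist_eq, sq_abs]
      exact single_le_sum (f := fun j => ((b - a) j) ^ 2) (fun j _ => sq_nonneg _) (mem_univ i)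
  have hvn : 0 < ‖v‖ := norm_pos_iff.2 hv0
  by_contra hle
  refine h hd (‖v‖⁻¹ • v) ?_ ⟨Sol_smul B v hv _ (by positivity), ?_⟩
  · simp [norm_smul, hvn.ne']
  · have : ∑ i, (‖v‖⁻¹ • v) i * b i = ‖v‖⁻¹ * ∑ i, v i * b i := by
      rw [mul_sum]; refine sum_congr rfl fun i _ => ?_
      simp; ring
    show ∑ i, (‖v‖⁻¹ • v) i * b i ≤ 0
    rw [this]
    exact mul_nonpos_of_nonneg_of_nonpos (by positivity) (not_lt.1 hle)

lemma aux_large {n k : ℕ} (hk : k ≠ 0) (B : Fin n → (Fin k → Fin n) → ℝ) (b : Fin n → ℝ)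
    (hB : ∀ x : Fin n → ℝ, (∀ i, 0 ≤ x i) → 0 ≤ ∑ i, x i * tApply B x i)
    (hb : ∀ v ∈ Sol B 0, v ≠ 0 → 0 < ∑ i, v i * b i) :
    ∃ R > (0 : ℝ), ∀ x : Fin n → ℝ, (∀ i, 0 ≤ x i) → R ≤ ‖x‖ →
      (∀ i, x i < ‖x‖ → 0 ≤ tApply B x i + b i) →
      (∀ i, x i * (tApply B x i + b i) ≤ 0) → False := by
  have hcl : IsClosed {z : ℝ × (Fin n → ℝ) |
      (∀ i, 0 ≤ z.2 i) ∧ (∀ i, 0 ≤ (1 - z.2 i) * (tApply B z.2 i + z.1 * b i)) ∧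
        (∀ i, z.2 i * (tApply B z.2 i + z.1 * b i) ≤ 0) ∧ ∑ i, z.2 i * b i ≤ 0} := by
    have hT : ∀ i, Continuous fun z : ℝ × (Fin n → ℝ) =>
        tApply B z.2 i := fun i => tApply_cont_comp (by fun_prop) (by fun_prop) i
    simp only [Set.ofPred_and, Set.ofPred_forall]
    refine IsClosed.inter ?_ (IsClosed.inter ?_ (IsClosed.inter ?_ ?_))
    · exact isClosed_iInter fun i => isClosed_le continuous_const (by fun_prop)
    · exact isClosed_iInter fun i => isClosed_le continuous_const (by fun_prop)
    · exact isClosed_iInter fun i => isClosed_le (by fun_prop) continuous_const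
    · exact isClosed_le (by fun_prop) continuous_const
  have hev : ∀ᶠ s in nhds (0 : ℝ), ∀ v ∈ Metric.sphere (0 : Fin n → ℝ) 1,
      ¬ ((∀ i, 0 ≤ v i) ∧ (∀ i, 0 ≤ (1 - v i) * (tApply B v i + s * b i)) ∧
        (∀ i, v i * (tApply B v i + s * b i) ≤ 0) ∧ ∑ i, v i * b i ≤ 0) := by
    refine (isCompact_sphere (0 : Fin n → ℝ) 1).eventually_forall_of_forall_eventually
      fun v hv => ?_
    refine hcl.isOpen_compl.mem_nhds ?_
    rintro ⟨h1, h2, h3, h4⟩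
    simp only [zero_mul, add_zero] at h1 h2 h3 h4
    have h5 : ∑ i, v i * tApply B v i = 0 :=
      le_antisymm (sum_nonpos fun i _ => h3 i) (hB v h1)
    have h6 := (sum_eq_zero_iff_of_nonpos (fun i _ => h3 i)).1 h5
    refine absurd (hb v ⟨h1, fun i => ?_, ?_⟩ ?_) (not_lt.2 h4)
    · have := h2 i
      have h7 := h6 i (mem_univ i)
      simp only [Pi.zero_apply, add_zero]
      linarith
    · simpa using h5
    · rintro rfl
      simp at hv
  obtain ⟨ε, hε, h⟩ := Metric.eventually_nhds_iff.1 hev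
  refine ⟨max 1 (2 / ε), by positivity, fun x hx hxR hx1 hx2 => ?_⟩
  set r := ‖x‖ with hr
  have hr1 : 1 ≤ r := (le_max_left _ _).trans hxR
  have hrε : 2 / ε ≤ r := (le_max_right _ _).trans hxR
  have hr0 : 0 < r := by linarith
  have hrk : r ≤ r ^ k := le_self_pow₀ hr1 hk
  have hrkp : 0 < r ^ k := by positivity
  have hF : ∀ i, tApply B (r⁻¹ • x) i + (r ^ k)⁻¹ * b i = (r ^ k)⁻¹ * (tApply B x i + b i) := by
    intro i
    rw [tApply_smul, inv_pow]; ring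
  refine h (y := (r ^ k)⁻¹) ?_ (r⁻¹ • x) ?_ ⟨fun i => ?_, fun i => ?_, fun i => ?_, ?_⟩
  · rw [Real.dist_eq, sub_zero, abs_of_pos (by positivity)]
    rw [inv_lt_comm₀ hrkp hε]
    have : ε⁻¹ < 2 / ε := by rw [inv_eq_one_div]; gcongr; norm_num
    linarith
  · simp [norm_smul, ← hr, abs_of_pos hr0, hr0.ne']
  · have := hx i
    simp only [Pi.smul_apply, smul_eq_mul]
    positivity
  · rw [hF]
    have hle : x i ≤ r := by
      have := norm_le_pi_norm x i
      rwa [Real.norm_of_nonneg (hx i)] at this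
    rcases hle.lt_or_eq with hlt | heq
    · have h1 := hx1 i hlt
      have h2 : (r⁻¹ • x) i ≤ 1 := by
        simp only [Pi.smul_apply, smul_eq_mul]
        rw [inv_mul_le_one₀ hr0]; exact hle
      exact mul_nonneg (by linarith) (by positivity)
    · have : (r⁻¹ • x) i = 1 := by
        simp only [Pi.smul_apply, smul_eq_mul, heq]
        exact inv_mul_cancel₀ hr0.ne'
      rw [this]; simp
  · rw [hF]
    have : (r⁻¹ • x) i * ((r ^ k)⁻¹ * (tApply B x i + b i)) =
        (r⁻¹ * (r ^ k)⁻¹) * (x i * (tApply B x i + b i)) := by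
      simp only [Pi.smul_apply, smul_eq_mul]; ring
    rw [this]
    exact mul_nonpos_of_nonneg_of_nonpos (by positivity) (hx2 i)
  · have h1 : ∑ i, x i * (tApply B x i + b i) ≤ 0 := sum_nonpos fun i _ => hx2 i
    have h2 := hB x hx
    simp only [mul_add, sum_add_distrib] at h1
    have h3 : ∑ i, (r⁻¹ • x) i * b i = r⁻¹ * ∑ i, x i * b i := by
      rw [mul_sum]; refine sum_congr rfl fun i _ => ?_
      simp only [Pi.smul_apply, smul_eq_mul]; ring
    rw [h3]
    exact mul_nonpos_of_nonneg_of_nonpos (by positivity) (by linarith)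

/-- if `a` lies in the interior of the dual cone of `Sol(A,0)`, then for all
copositive `B` and all `b` close enough to `(A,a)`, `Sol(B,b)` is nonempty and bounded. -/
theorem stmt_19 (m n : ℕ) (hm : 2 ≤ m) (hn : 2 ≤ n) (A : Fin n → (Fin (m - 1) → Fin n) → ℝ) (a : Fin n → ℝ)
    (ha : a ∈ interior {q : Fin n → ℝ | ∀ v ∈ Sol A 0, 0 ≤ ∑ i, v i * q i}) :
    ∃ ε > (0 : ℝ), ∀ (B : Fin n → (Fin (m - 1) → Fin n) → ℝ) (b : Fin n → ℝ),
      (∀ x : Fin n → ℝ, (∀ i, 0 ≤ x i) → 0 ≤ ∑ i, x i * tApply B x i) →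
      max (tNorm (B - A)) (eNorm (b - a)) < ε →
      (Sol B b).Nonempty ∧ Bornology.IsBounded (Sol B b) := by
  obtain ⟨ε, hε, H⟩ := aux_eps A a (aux_dual A a ha)
  refine ⟨ε, hε, fun B b hB hBb => ?_⟩
  obtain ⟨R, hR, hlarge⟩ := aux_large (by omega) B b hB (H B b hBb)
  constructor
  · obtain ⟨z, hz0, hzR, hz1, hz2⟩ := aux_box (fun x => tApply B x + b)
      ((tApply_cont.comp (continuous_const.prodMk continuous_id)).add continuous_const) R hR
    simp only [Pi.add_apply] at hz1 hz2
    have hzn : ‖z‖ ≤ R := by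
      rw [pi_norm_le_iff_of_nonneg hR.le]
      intro i
      rw [Real.norm_of_nonneg (hz0 i)]; exact hzR i
    have hz3 : ∀ i, z i * (tApply B z i + b i) ≤ 0 := by
      intro i
      rcases (hz0 i).eq_or_lt with h | h
      · rw [← h]; simp
      · exact mul_nonpos_of_nonneg_of_nonpos h.le (hz2 i h)
    have hlt : ‖z‖ < R := by
      by_contra hge
      have heq : ‖z‖ = R := le_antisymm hzn (not_lt.1 hge)
      exact hlarge z hz0 heq.ge (fun i hi => hz1 i (heq ▸ hi)) hz3
    have hzi : ∀ i, 0 ≤ tApply B z i + b i := by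
      intro i
      refine hz1 i (lt_of_le_of_lt ?_ hlt)
      exact (le_abs_self _).trans (norm_le_pi_norm z i)
    refine ⟨z, hz0, hzi, sum_eq_zero fun i _ => le_antisymm (hz3 i) (mul_nonneg (hz0 i) (hzi i))⟩
  · refine (Metric.isBounded_closedBall (x := (0 : Fin n → ℝ)) (r := R)).subset ?_
    rintro x ⟨h1, h2, h3⟩
    rw [mem_closedBall_zero_iff]
    by_contra hlt
    have h4 := (sum_eq_zero_iff_of_nonneg (fun i _ => mul_nonneg (h1 i) (h2 i))).1 h3
    exact hlarge x h1 (not_le.1 hlt).le (fun i _ => h2 i) (fun i => (h4 i (mem_univ i)).le)
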